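/- Let w be a binary word over {a,b}. Then w is CR-poor if and only if w is bitonic, i.e., of the form a^i b^j a^k or b^i a^j b^k for some i, j, k ≥ 0. -/

import Mathlib

variable {α : Type*}

/-- `u` is a factor (contiguous subword) of `w`. -/
def IsFactor (u w : List α) : Prop := ∃ v z : List α, w = v ++ u ++ z

/-- `u` is a border of `w`: a word different from `w` that is both a prefix and a suffix. -/
def IsBorder (u w : List α) : Prop := u ≠ w ∧ u <+: w ∧ u <:+ w

/-- `u` has an internal occurrence in `w`. -/
def HasInternalOcc (u w : List α) : Prop :=
  ∃ v z : List α, v ≠ [] ∧ z ≠ [] ∧ w = v ++ u ++ z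

/-- A word is closed if it is empty or has a border with no internal occurrence. -/
def ClosedWord (w : List α) : Prop :=
  w = [] ∨ ∃ u : List α, IsBorder u w ∧ ¬ HasInternalOcc u w

/-- The set of closed factors of `w`. -/
def closedFactors (w : List α) : Set (List α) := {u | IsFactor u w ∧ ClosedWord u}

/-- A word is CR-poor if it has exactly `|w| + 1` closed factors. -/
def IsCRPoor (w : List α) : Prop := (closedFactors w).ncard = w.length + 1

/-- `w` is a complete return to `u`: exactly two occurrences of `u` in `w`,
one as a prefix and one as a suffix. -/
def IsCompleteReturn (u w : List α) : Prop :=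
  u <+: w ∧ u <:+ w ∧ {i : ℕ | i + u.length ≤ w.length ∧ u <+: w.drop i}.ncard = 2

/-- The set of palindromic factors of `w`. -/
def palFactors (w : List α) : Set (List α) := {u | IsFactor u w ∧ u.reverse = u}

/-- `k`-fold concatenation power of a word. -/
def listPow (u : List α) : ℕ → List α
  | 0 => []
  | k + 1 => u ++ listPow u k

/-- A word is primitive if it is nonempty and not a power `u^k` with `k ≥ 2`. -/
def Primitive (v : List α) : Prop :=
  v ≠ [] ∧ ∀ (u : List α) (k : ℕ), 2 ≤ k → v ≠ listPow u k

/-- `p` is a period of `w`. -/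
def HasPeriod (w : List α) (p : ℕ) : Prop := 0 < p ∧ p ≤ w.length ∧ w.drop p <+: w


theorem cr_factor_iff {α : Type*} {u w : List α} : IsFactor u w ↔ u <:+: w := by
  constructor
  · rintro ⟨v, z, h⟩; exact ⟨v, z, h.symm⟩
  · rintro ⟨v, z, h⟩; exact ⟨v, z, h.symm⟩

theorem cr_finite {α : Type*} (w : List α) : (closedFactors w).Finite := by
  refine Set.Finite.subset (List.finite_toSet w.sublists) ?_
  rintro u ⟨h, -⟩
  exact List.mem_sublists.2 (cr_factor_iff.1 h).sublist

theorem cr_mono {α : Type*} {u w : List α} (h : u <:+: w) : closedFactors u ⊆ closedFactors w := by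
  rintro t ⟨h1, h2⟩
  exact ⟨cr_factor_iff.2 ((cr_factor_iff.1 h1).trans h), h2⟩

theorem cr_cons_new {α : Type*} (x : α) (w : List α) :
    ∃ u, u ∈ closedFactors (x :: w) ∧ u ∉ closedFactors w := by
  classical
  obtain ⟨m, hm, hmax⟩ : ∃ m, (m ≤ w.length ∧ (x :: w).take m <:+: w) ∧
      ∀ m', m' ≤ w.length ∧ (x :: w).take m' <:+: w → m' ≤ m := by
    let P : ℕ → Prop := fun m => m ≤ w.length ∧ (x :: w).take m <:+: w
    have h0 : P 0 := ⟨Nat.zero_le _, by simp⟩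
    refine ⟨Nat.findGreatest P w.length, Nat.findGreatest_spec (P := P) (Nat.zero_le _) h0, ?_⟩
    intro m' hm'
    exact Nat.le_findGreatest hm'.1 hm'
  obtain ⟨hml, hmf⟩ := hm
  set s := (x :: w).take m with hs
  have hsl : s.length = m := by rw [hs, List.length_take]; simp; omega
  have hsp : s <+: x :: w := List.take_prefix _ _
  have hex : ∃ n, ∃ v z : List α, v.length = n ∧ w = v ++ s ++ z := by
    obtain ⟨v, z, h⟩ := hmf
    exact ⟨_, v, z, rfl, h.symm⟩
  obtain ⟨v, z, hvl, hw⟩ := Nat.find_spec hex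
  have hmin : ∀ v' z', w = v' ++ s ++ z' → v.length ≤ v'.length := by
    intro v' z' h
    rw [hvl]
    exact Nat.find_min' hex ⟨v', z', rfl, h⟩
  have hup : x :: v ++ s <+: x :: w := ⟨z, by rw [hw]; simp⟩
  refine ⟨x :: v ++ s, ⟨cr_factor_iff.2 hup.isInfix, Or.inr ⟨s, ⟨?_, ?_, ?_⟩, ?_⟩⟩, ?_⟩
  · intro h
    have := congrArg List.length h
    simp at this
    omega
  · exact List.prefix_of_prefix_length_le hsp hup (by simp; omega)
  · exact List.suffix_append _ _
  · rintro ⟨v', z', hv', hz', h⟩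
    cases v' with
    | nil => exact hv' rfl
    | cons c v'' =>
      simp only [List.cons_append, List.cons.injEq] at h
      have h2 := hmin v'' (z' ++ z) (by rw [hw, h.2]; simp)
      have h3 := congrArg List.length h.2
      have h4 := List.length_pos_iff.2 hz'
      simp at h3
      omega
  · rintro ⟨hf, -⟩
    have hf := cr_factor_iff.1 hf
    have hle := hf.length_le
    have := hmax (x :: v ++ s).length ⟨hle, by
      rw [← List.prefix_iff_eq_take.1 hup]; exact hf⟩
    simp at this
    omega

theorem cr_cons_le {α : Type*} (x : α) (w : List α) :
    (closedFactors w).ncard + 1 ≤ (closedFactors (x :: w)).ncard := by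
  obtain ⟨u, h1, h2⟩ := cr_cons_new x w
  refine Set.ncard_lt_ncard ?_ (cr_finite _)
  refine ⟨cr_mono (List.suffix_cons x w).isInfix, fun h => h2 (h h1)⟩

theorem cr_closed_reverse {α : Type*} {w : List α} (h : ClosedWord w) : ClosedWord w.reverse := by
  rcases h with h | ⟨u, ⟨h1, h2, h3⟩, h4⟩
  · left; simp [h]
  · right
    refine ⟨u.reverse, ⟨fun h => h1 (List.reverse_injective h), List.reverse_prefix.2 h3,
      List.reverse_suffix.2 h2⟩, ?_⟩
    rintro ⟨v, z, hv, hz, h⟩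
    refine h4 ⟨z.reverse, v.reverse, by simpa using hz, by simpa using hv, ?_⟩
    have := congrArg List.reverse h
    simpa using this

theorem cr_reverse_sub {α : Type*} (w : List α) :
    List.reverse '' closedFactors w ⊆ closedFactors w.reverse := by
  rintro _ ⟨u, ⟨h1, h2⟩, rfl⟩
  exact ⟨cr_factor_iff.2 (List.reverse_infix.2 (cr_factor_iff.1 h1)), cr_closed_reverse h2⟩

theorem cr_reverse_le {α : Type*} (w : List α) :
    (closedFactors w).ncard ≤ (closedFactors w.reverse).ncard := by
  rw [← Set.ncard_image_of_injective _ (List.reverse_injective (α := α))]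
  exact Set.ncard_le_ncard (cr_reverse_sub w) (cr_finite _)

theorem cr_append_left {α : Type*} (v w : List α) :
    (closedFactors w).ncard + v.length ≤ (closedFactors (v ++ w)).ncard := by
  induction v with
  | nil => simp
  | cons x v ih =>
    have := cr_cons_le x (v ++ w)
    simp only [List.cons_append, List.length_cons]
    omega

theorem cr_append_right {α : Type*} (w z : List α) :
    (closedFactors w).ncard + z.length ≤ (closedFactors (w ++ z)).ncard := by
  have h1 := cr_reverse_le w
  have h2 := cr_append_left z.reverse w.reverse
  have h3 := cr_reverse_le (z.reverse ++ w.reverse)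
  simp at h2 h3
  omega

theorem cr_lower {α : Type*} (w : List α) : w.length + 1 ≤ (closedFactors w).ncard := by
  have h := cr_append_left w []
  have h2 : 0 < (closedFactors ([] : List α)).ncard :=
    (Set.ncard_pos (cr_finite _)).2 ⟨[], ⟨⟨[], [], rfl⟩, Or.inl rfl⟩⟩
  simp at h
  omega

theorem cr_getElem? {α : Type*} (x y : α) (p q r t : ℕ) :
    (List.replicate p x ++ List.replicate q y ++ List.replicate r x)[t]? =
      if t < p then some x else if t < p + q then some y else
        if t < p + q + r then some x else none := by
  simp only [List.getElem?_append, List.getElem?_replicate, List.length_append,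
    List.length_replicate]
  grind

/-- the bad word -/
theorem cr_bad {α : Type*} {x y : α} (hxy : x ≠ y) (j k : ℕ) (hj : 0 < j) (hk : 0 < k) :
    j + k + 4 ≤ (closedFactors (x :: (List.replicate j y ++ List.replicate k x ++ [y]))).ncard := by
  set f := x :: (List.replicate j y ++ List.replicate k x ++ [y]) with hf
  set g := x :: (List.replicate j y ++ List.replicate k x) with hg
  have hgf : f = g ++ [y] := by simp [hf, hg]
  have hgl := cr_lower g
  have hglen : g.length = j + k + 1 := by simp [hg]
  have hgq : ∀ t, g[t]? = if t < 1 then some x else if t < 1 + j then some y else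
        if t < 1 + j + k then some x else none := by
    intro t
    rw [← cr_getElem? x y 1 j k t]; simp [hg, List.replicate_one]
  have hfq : ∀ t, f[t]? = if t < 1 then some x else if t < 1 + j then some y else
        if t < 1 + j + k then some x else if t < 1 + j + k + 1 then some y else none := by
    intro t
    rw [hgf, List.getElem?_append, hglen, hgq]
    split_ifs <;> first | rfl | omega | skip
    · have : t - (j + k + 1) = 0 := by omega
      simp [this]
    · have : t - (j + k + 1) ≠ 0 := by omega
      simp [this]
  -- first new factor
  have hr1 : y :: (List.replicate k x ++ [y]) ∈ closedFactors f := by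
    refine ⟨⟨x :: List.replicate (j-1) y, [], ?_⟩, Or.inr ⟨[y], ⟨?_, ?_, ?_⟩, ?_⟩⟩
    · obtain ⟨j, rfl⟩ : ∃ i, j = i + 1 := ⟨j - 1, by omega⟩
      simp [hf, List.replicate_succ']
    · simp
    · simp
    · exact ⟨y :: List.replicate k x, by simp⟩
    · rintro ⟨v, z, hv, hz, h⟩
      cases v with
      | nil => exact hv rfl
      | cons c v =>
        rcases List.eq_nil_or_concat z with rfl | ⟨z, d, rfl⟩
        · exact hz rfl
        · simp only [List.cons_append, List.cons.injEq, List.concat_eq_append] at h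
          have h2 := h.2
          rw [← List.append_assoc] at h2
          have h3 := (List.append_inj' h2 rfl).1
          have : y ∈ List.replicate k x := by rw [h3]; simp
          exact hxy (List.eq_of_mem_replicate this).symm
  have hn1 : y :: (List.replicate k x ++ [y]) ∉ closedFactors g := by
    rintro ⟨⟨v, z, h⟩, -⟩
    have hlen := congrArg List.length h
    simp [hglen] at hlen
    have e1 := congrArg (fun l => l[v.length + (k + 1)]?) h
    have e2 := congrArg (fun l => l[v.length + 1]?) h
    have e3 := congrArg (fun l => l[v.length]?) h
    simp only [hgq] at e1 e2 e3
    simp [List.getElem?_append, List.getElem?_cons, List.getElem?_replicate] at e1 e2 e3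
    grind
  have hr2 : f ∈ closedFactors f := by
    refine ⟨⟨[], [], by simp⟩, Or.inr ⟨[x, y], ⟨?_, ?_, ?_⟩, ?_⟩⟩
    · intro h
      have := congrArg List.length h
      simp [hf] at this
      omega
    · obtain ⟨j, rfl⟩ : ∃ i, j = i + 1 := ⟨j - 1, by omega⟩
      exact ⟨List.replicate j y ++ List.replicate k x ++ [y], by simp [hf, List.replicate_succ]⟩
    · obtain ⟨k, rfl⟩ : ∃ i, k = i + 1 := ⟨k - 1, by omega⟩
      exact ⟨x :: List.replicate j y ++ List.replicate k x, by simp [hf, List.replicate_succ']⟩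
    · rintro ⟨v, z, hv, hz, h⟩
      have h1 := List.length_pos_iff.2 hv
      have h2 := List.length_pos_iff.2 hz
      have hlen := congrArg List.length h
      rw [hgf] at hlen
      simp [hglen] at hlen
      have e1 := congrArg (fun l => l[v.length + 1]?) h
      have e3 := congrArg (fun l => l[v.length]?) h
      simp only [hfq] at e1 e3
      simp [List.getElem?_append] at e1 e3
      grind
  have hn2 : f ∉ closedFactors g := by
    rintro ⟨h, -⟩
    have := (cr_factor_iff.1 h).length_le
    rw [hgf] at this
    simp at this
  have hne : y :: (List.replicate k x ++ [y]) ≠ f := by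
    intro h
    rw [hf] at h
    exact hxy (List.cons.inj h).1.symm
  have hsub : insert f (insert (y :: (List.replicate k x ++ [y])) (closedFactors g)) ⊆
      closedFactors f := by
    refine Set.insert_subset hr2 (Set.insert_subset hr1 (cr_mono ?_))
    rw [hgf]; exact (List.prefix_append _ _).isInfix
  have := Set.ncard_le_ncard hsub (cr_finite f)
  rw [Set.ncard_insert_of_notMem (by
      simp only [Set.mem_insert_iff, not_or]; exact ⟨hne.symm, hn2⟩)
      ((cr_finite g).insert _), Set.ncard_insert_of_notMem hn1 (cr_finite g)] at this
  omega

theorem cr_not_poor {α : Type*} {x y : α} (hxy : x ≠ y) (j k : ℕ) (hj : 0 < j) (hk : 0 < k)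
    {w : List α} (h : (x :: (List.replicate j y ++ List.replicate k x ++ [y])) <:+: w) :
    ¬ IsCRPoor w := by
  obtain ⟨v, z, rfl⟩ := h
  have h1 := cr_bad hxy j k hj hk
  have h2 := cr_append_left v (x :: (List.replicate j y ++ List.replicate k x ++ [y]))
  have h3 := cr_append_right (v ++ (x :: (List.replicate j y ++ List.replicate k x ++ [y]))) z
  intro h
  unfold IsCRPoor at h
  rw [h] at h3
  simp at h1 h2 h3
  omega

theorem cr_step {α : Type*} (a b : α) (i j k : ℕ) :
    (∃ i' j' k' : ℕ, b :: (List.replicate i a ++ List.replicate j b ++ List.replicate k a) =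
      List.replicate i' b ++ List.replicate j' a ++ List.replicate k' b) ∨
    (∃ i' j' k' : ℕ, b :: (List.replicate i a ++ List.replicate j b ++ List.replicate k a) =
      List.replicate i' a ++ List.replicate j' b ++ List.replicate k' a) ∨
    (∃ j' k', 0 < j' ∧ 0 < k' ∧ (b :: (List.replicate j' a ++ List.replicate k' b ++ [a])) <:+:
      b :: (List.replicate i a ++ List.replicate j b ++ List.replicate k a)) := by
  rcases Nat.eq_zero_or_pos i with rfl | hi
  · right; left
    exact ⟨0, j + 1, k, by simp [List.replicate_succ]⟩
  rcases Nat.eq_zero_or_pos j with rfl | hj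
  · left
    exact ⟨1, i + k, 0, by simp⟩
  rcases Nat.eq_zero_or_pos k with rfl | hk
  · left
    exact ⟨1, i, j, by simp⟩
  right; right
  refine ⟨i, j, hi, hj, [], List.replicate (k - 1) a, ?_⟩
  obtain ⟨k, rfl⟩ : ∃ i, k = i + 1 := ⟨k - 1, by omega⟩
  simp [List.replicate_succ]

theorem cr_bitonic_or {α : Type*} (a b : α) (hbin : ∀ c : α, c = a ∨ c = b) (w : List α) :
    (∃ i j k : ℕ,
        w = List.replicate i a ++ List.replicate j b ++ List.replicate k a ∨
        w = List.replicate i b ++ List.replicate j a ++ List.replicate k b) ∨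
    (∃ j k, 0 < j ∧ 0 < k ∧ ((a :: (List.replicate j b ++ List.replicate k a ++ [b])) <:+: w ∨
      (b :: (List.replicate j a ++ List.replicate k b ++ [a])) <:+: w)) := by
  induction w with
  | nil => left; exact ⟨0, 0, 0, by simp⟩
  | cons c w ih =>
    rcases ih with ⟨i, j, k, h | h⟩ | ⟨j, k, hj, hk, h⟩
    · rcases hbin c with rfl | rfl
      · left; exact ⟨i + 1, j, k, Or.inl (by simp [h, List.replicate_succ])⟩
      · rw [h]
        rcases cr_step a c i j k with ⟨i', j', k', h'⟩ | ⟨i', j', k', h'⟩ | ⟨j', k', h1, h2, h3⟩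
        · left; exact ⟨i', j', k', Or.inr h'⟩
        · left; exact ⟨i', j', k', Or.inl h'⟩
        · right; exact ⟨j', k', h1, h2, Or.inr h3⟩
    · rcases hbin c with rfl | rfl
      · rw [h]
        rcases cr_step b c i j k with ⟨i', j', k', h'⟩ | ⟨i', j', k', h'⟩ | ⟨j', k', h1, h2, h3⟩
        · left; exact ⟨i', j', k', Or.inl h'⟩
        · left; exact ⟨i', j', k', Or.inr h'⟩
        · right; exact ⟨j', k', h1, h2, Or.inl h3⟩
      · left; exact ⟨i + 1, j, k, Or.inr (by simp [h, List.replicate_succ])⟩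
    · right
      have hs := (List.suffix_cons c w).isInfix
      exact ⟨j, k, hj, hk, h.imp (fun h => h.trans hs) (fun h => h.trans hs)⟩

theorem cr_border_le {α : Type*} {x y : α} (hxy : x ≠ y) {p q r : ℕ} (hp : 0 < p) (hq : 0 < q)
    {v : List α}
    (hb : IsBorder v (List.replicate p x ++ List.replicate q y ++ List.replicate r x)) :
    v.length ≤ p := by
  obtain ⟨hne, ⟨z, hz⟩, ⟨d, hd⟩⟩ := hb
  have hd0 : 0 < d.length := by
    rw [List.length_pos_iff]; rintro rfl; exact hne (by simpa using hd)
  by_contra! hlt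
  have hlen := congrArg List.length hd
  simp at hlen
  have key : ∀ t, t < v.length →
      (List.replicate p x ++ List.replicate q y ++ List.replicate r x)[t]? =
      (List.replicate p x ++ List.replicate q y ++ List.replicate r x)[d.length + t]? := by
    intro t ht
    rw [show (List.replicate p x ++ List.replicate q y ++ List.replicate r x)[t]? = v[t]? by
      rw [← hz, List.getElem?_append_left ht]]
    rw [← hd, List.getElem?_append_right (by omega)]
    simp
  simp only [cr_getElem?] at key
  have k0 := key 0 (by omega)
  have k1 := key p hlt
  have k2 := key (p - d.length) (by omega)
  grind

theorem cr_closed_eq {α : Type*} {x y : α} (hxy : x ≠ y) {p q r : ℕ} (hq : 0 < q)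
    (hc : ClosedWord (List.replicate p x ++ List.replicate q y ++ List.replicate r x)) :
    p = r := by
  rcases hc with h | ⟨v, hb, hni⟩
  · simp at h; omega
  by_contra hpr
  have hb' : IsBorder v.reverse
      (List.replicate r x ++ List.replicate q y ++ List.replicate p x) := by
    obtain ⟨h1, h2, h3⟩ := hb
    have e : List.replicate r x ++ List.replicate q y ++ List.replicate p x =
      (List.replicate p x ++ List.replicate q y ++ List.replicate r x).reverse := by simp
    rw [e]
    exact ⟨fun h => h1 (List.reverse_injective h), List.reverse_prefix.2 h3,
      List.reverse_suffix.2 h2⟩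
  have l1 : 0 < p → v.length ≤ p := fun hp => cr_border_le hxy hp hq hb
  have l2 : 0 < r → v.length ≤ r := fun hr => by
    simpa using cr_border_le hxy hr hq hb'
  obtain ⟨hne, ⟨z, hz⟩, ⟨d, hd⟩⟩ := hb
  have hlz := congrArg List.length hz
  have hld := congrArg List.length hd
  simp at hlz hld
  have g1 : ∀ t, t < v.length → v[t]? =
      (List.replicate p x ++ List.replicate q y ++ List.replicate r x)[t]? := by
    intro t ht
    rw [← hz, List.getElem?_append_left ht]
  have g2 : ∀ t, t < v.length → v[t]? =
      (List.replicate p x ++ List.replicate q y ++ List.replicate r x)[d.length + t]? := by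
    intro t ht
    rw [← hd, List.getElem?_append_right (by omega)]
    simp
  simp only [cr_getElem?] at g1 g2
  have hvp : v.length ≤ p := by
    by_contra! h
    have := g1 0 (by omega)
    have := g2 0 (by omega)
    grind
  have hvr : v.length ≤ r := by
    by_contra! h
    have := g1 (v.length - 1) (by omega)
    have := g2 (v.length - 1) (by omega)
    grind
  have hv : v = List.replicate v.length x := by
    apply List.ext_getElem?
    intro t
    by_cases ht : t < v.length
    · rw [g1 t ht, if_pos (by omega)]; simp [ht]
    · simp [ht]
  generalize v.length = m at *
  apply hni
  rw [hv]
  rcases Nat.lt_or_gt_of_ne hpr with h | h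
  · obtain ⟨c, rfl⟩ : ∃ c, r = m + (c + 1) := ⟨r - m - 1, by omega⟩
    refine ⟨List.replicate p x ++ List.replicate q y, List.replicate (c + 1) x, ?_, ?_, ?_⟩
    · simp; omega
    · simp
    · simp
  · obtain ⟨c, rfl⟩ : ∃ c, p = 1 + m + c := ⟨p - m - 1, by omega⟩
    refine ⟨[x], List.replicate c x ++ List.replicate q y ++ List.replicate r x, ?_, ?_, ?_⟩
    · simp
    · simp; omega
    · simp only [List.replicate_add, List.replicate_one, List.append_assoc]

theorem cr_factor_form {α : Type*} (x y : α) (i j k : ℕ) (hj : 0 < j) (u : List α)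
    (h : u <:+: List.replicate i x ++ List.replicate j y ++ List.replicate k x) :
    (∃ m ≤ max i k, u = List.replicate m x) ∨
    ∃ p q r, 0 < q ∧ p ≤ i ∧ q ≤ j ∧ r ≤ k ∧ (0 < p → 0 < r → q = j) ∧
      u = List.replicate p x ++ List.replicate q y ++ List.replicate r x := by
  obtain ⟨v, z, h⟩ := h
  have hlen := congrArg List.length h
  simp at hlen
  have hu : ∀ t, t < u.length → u[t]? =
      (List.replicate i x ++ List.replicate j y ++ List.replicate k x)[v.length + t]? := by
    intro t ht
    rw [← h, List.getElem?_append_left (by simp; omega), List.getElem?_append_right (by omega)]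
    simp
  simp only [cr_getElem?] at hu
  set s := v.length
  set n := u.length with hn
  by_cases hc : n = 0 ∨ s + n ≤ i ∨ i + j ≤ s
  · left
    refine ⟨n, by omega, ?_⟩
    apply List.ext_getElem?
    intro t
    by_cases ht : t < n
    · rw [hu t ht]; simp [ht]; grind
    · rw [List.getElem?_eq_none (by omega), List.getElem?_eq_none (by simp; omega)]
  · right
    refine ⟨i - s, min (i + j) (s + n) - max i s, s + n - (i + j), by omega, by omega, by omega,
      by omega, by omega, ?_⟩
    apply List.ext_getElem?
    intro t
    rw [cr_getElem?]
    by_cases ht : t < n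
    · rw [hu t ht]; grind
    · rw [List.getElem?_eq_none (by omega)]; grind

theorem cr_upper {α : Type*} {x y : α} (hxy : x ≠ y) (i j k : ℕ) (hj : 0 < j) :
    (closedFactors
      (List.replicate i x ++ List.replicate j y ++ List.replicate k x)).ncard ≤ i + j + k + 1 := by
  classical
  let S : Finset (List α) :=
    (Finset.range (max i k + 1)).image (fun m => List.replicate m x) ∪
    (Finset.Icc 1 j).image (fun m => List.replicate m y) ∪
    (Finset.Icc 1 (min i k)).image
      (fun m => List.replicate m x ++ List.replicate j y ++ List.replicate m x)
  have hS : S.card ≤ i + j + k + 1 := by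
    refine (Finset.card_union_le _ _).trans ?_
    have h1 := Finset.card_union_le
      ((Finset.range (max i k + 1)).image (fun m => List.replicate m x))
      ((Finset.Icc 1 j).image (fun m => List.replicate m y))
    have h2 := Finset.card_image_le (s := Finset.range (max i k + 1))
      (f := fun m => List.replicate m x)
    have h3 := Finset.card_image_le (s := Finset.Icc 1 j) (f := fun m => List.replicate m y)
    have h4 := Finset.card_image_le (s := Finset.Icc 1 (min i k))
      (f := fun m => List.replicate m x ++ List.replicate j y ++ List.replicate m x)
    rw [Finset.card_range] at h2
    rw [Nat.card_Icc] at h3 h4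
    omega
  refine le_trans ?_ hS
  rw [← Set.ncard_coe_finset]
  refine Set.ncard_le_ncard ?_ (Finset.finite_toSet _)
  rintro u ⟨hf, hc⟩
  simp only [S, Finset.coe_union, Finset.coe_image, Set.mem_union, Set.mem_image, Finset.mem_coe,
    Finset.mem_range, Finset.mem_Icc]
  rcases cr_factor_form x y i j k hj u (cr_factor_iff.1 hf) with
    ⟨m, hm, rfl⟩ | ⟨p, q, r, hq, hpi, hqj, hrk, hpr, rfl⟩
  · left; left; exact ⟨m, by omega, rfl⟩
  · obtain rfl := cr_closed_eq hxy hq hc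
    rcases Nat.eq_zero_or_pos p with rfl | hp
    · left; right; exact ⟨q, ⟨hq, hqj⟩, by simp⟩
    · obtain rfl := hpr hp hp
      right; exact ⟨p, ⟨hp, by omega⟩, rfl⟩

theorem cr_bitonic_poor {α : Type*} {x y : α} (hxy : x ≠ y) (i j k : ℕ) :
    IsCRPoor (List.replicate i x ++ List.replicate j y ++ List.replicate k x) := by
  unfold IsCRPoor
  apply le_antisymm
  · rcases Nat.eq_zero_or_pos j with rfl | hj
    · rcases Nat.eq_zero_or_pos (i + k) with h | h
      · obtain ⟨rfl, rfl⟩ : i = 0 ∧ k = 0 := by omega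
        have : closedFactors ([] : List α) ⊆ {[]} := by
          rintro u ⟨h, -⟩
          simpa using cr_factor_iff.1 h
        simpa using Set.ncard_le_ncard this
      · have := cr_upper hxy.symm 0 (i + k) 0 h
        simpa using this
    · have := cr_upper hxy i j k hj
      simpa [Nat.add_assoc] using this
  · exact cr_lower _

/-- A binary word is CR-poor iff it is bitonic, i.e. of the form a^i b^j a^k or
b^i a^j b^k. -/
theorem stmt_16 {α : Type*} (a b : α) (hab : a ≠ b) (hbin : ∀ c : α, c = a ∨ c = b)
    (w : List α) :
    IsCRPoor w ↔
      ∃ i j k : ℕ,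
        w = List.replicate i a ++ List.replicate j b ++ List.replicate k a ∨
        w = List.replicate i b ++ List.replicate j a ++ List.replicate k b := by
  constructor
  · intro h
    rcases cr_bitonic_or a b hbin w with h' | ⟨j, k, hj, hk, h' | h'⟩
    · exact h'
    · exact absurd h (cr_not_poor hab j k hj hk h')
    · exact absurd h (cr_not_poor hab.symm j k hj hk h')
  · rintro ⟨i, j, k, rfl | rfl⟩
    · exact cr_bitonic_poor hab i j k
    · exact cr_bitonic_poor hab.symm i j k
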